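/- The operator K from the previous statement, K: C_S(B₄) → C_S(B₄), (KΛ)(x) = -(1/U₀'(|x|)) ∫_{B₃}(1/|x-y| - 1/|y|) ρ₀'(|y|) Λ(y) dy, is a compact linear operator on the Banach space C_S(B₄) of continuous functions on B₄ invariant under the three coordinate reflections, equipped with the sup norm. -/

import Mathlib

open Metric Real MeasureTheory Filter

/-- Reflection across the coordinate plane `x_i = 0`. -/
noncomputable def coordFlip (i : Fin 3) (x : EuclideanSpace ℝ (Fin 3)) :
    EuclideanSpace ℝ (Fin 3) :=
  (EuclideanSpace.equiv (Fin 3) ℝ).symm (fun j => if j = i then -(x j) else x j)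

local notation "Space3" => EuclideanSpace ℝ (Fin 3)

lemma coordFlip_coordFlip_coordFlip (x : Space3) :
    coordFlip 0 (coordFlip 1 (coordFlip 2 x)) = -x := by
  ext j
  fin_cases j <;> simp [coordFlip, EuclideanSpace.equiv]

lemma integrableOn_norm_rpow_neg_ball {p : ℝ} (hp : p < 3) (R : ℝ) :
    IntegrableOn (fun z : Space3 => ‖z‖ ^ (-p)) (ball 0 R) := by
  rw [integrableOn_fun_norm_addHaar (volume : Measure Space3) (f := fun r => r ^ (-p))]
  rcases le_or_gt R 0 with hR | hR
  · simp [Set.Ioo_eq_empty_of_le hR]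
  refine ((intervalIntegral.integrableOn_Ioo_rpow_iff (s := 2 - p) hR).2
    (by linarith)).congr_fun (fun y hy => ?_) measurableSet_Ioo
  simp only [finrank_euclideanSpace, Fintype.card_fin, smul_eq_mul]
  rw [sub_eq_add_neg, Real.rpow_add hy.1]
  norm_num

/-- Local integrals of `‖x - y‖ ^ (-p)`, `p < 3`, are bounded uniformly for bounded `x`. -/
lemma exists_setIntegral_norm_sub_rpow_neg_le {p : ℝ} (hp : p < 3) (R r : ℝ) :
    ∃ J : ℝ, ∀ x : Space3, ‖x‖ ≤ R →
      IntegrableOn (fun y => ‖x - y‖ ^ (-p)) (closedBall 0 r) ∧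
        ∫ y in closedBall (0 : Space3) r, ‖x - y‖ ^ (-p) ≤ J := by
  refine ⟨∫ z in ball (0 : Space3) (R + r + 1), ‖z‖ ^ (-p), fun x hx => ?_⟩
  set F : Space3 → ℝ := (ball (0 : Space3) (R + r + 1)).indicator fun z => ‖z‖ ^ (-p)
  have hF : Integrable F :=
    (integrable_indicator_iff measurableSet_ball).2 (integrableOn_norm_rpow_neg_ball hp _)
  have hF0 : ∀ z, 0 ≤ F z := fun z => Set.indicator_nonneg (fun _ _ => by positivity) z
  have hFx : Integrable fun y => F (x - y) := hF.comp_sub_left x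
  have heq : Set.EqOn (fun y => F (x - y)) (fun y => ‖x - y‖ ^ (-p)) (closedBall 0 r) := by
    intro y hy
    refine Set.indicator_of_mem ?_ _
    rw [mem_ball_zero_iff]
    have := norm_sub_le x y
    rw [mem_closedBall_zero_iff] at hy
    linarith
  refine ⟨hFx.integrableOn.congr_fun heq measurableSet_closedBall, ?_⟩
  rw [← setIntegral_congr_fun measurableSet_closedBall heq,
    ← integral_indicator measurableSet_ball]
  calc ∫ y in closedBall (0 : Space3) r, F (x - y) ≤ ∫ y, F (x - y) :=
        setIntegral_le_integral hFx (Eventually.of_forall fun y => hF0 _)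
    _ = ∫ y, F y := integral_sub_left_eq_self F volume x

lemma integrableOn_norm_sub_rpow_neg {p : ℝ} (hp : p < 3) (r : ℝ) (x : Space3) :
    IntegrableOn (fun y => ‖x - y‖ ^ (-p)) (closedBall 0 r) :=
  let ⟨_, h⟩ := exists_setIntegral_norm_sub_rpow_neg_le hp ‖x‖ r
  (h x le_rfl).1

lemma integrableOn_newtonKernel (r : ℝ) (x : Space3) :
    IntegrableOn (fun y : Space3 => 1 / ‖x - y‖ - 1 / ‖y‖) (closedBall 0 r) := by
  have h := (integrableOn_norm_sub_rpow_neg (p := 1) (by norm_num) r x).sub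
    (integrableOn_norm_sub_rpow_neg (p := 1) (by norm_num) r 0)
  refine h.congr_fun (fun y _ => ?_) measurableSet_closedBall
  simp [Real.rpow_neg_one]

lemma integrableOn_inner_div_norm_cube (r : ℝ) (x : Space3) :
    IntegrableOn (fun y : Space3 => inner ℝ x y / ‖y‖ ^ 3) (closedBall 0 r) := by
  have h := (integrableOn_norm_sub_rpow_neg (p := 2) (by norm_num) r 0).const_mul ‖x‖
  have hm : Measurable fun y : Space3 => inner ℝ x y / ‖y‖ ^ 3 :=
    (by fun_prop : Measurable fun y : Space3 => inner ℝ x y).div (by fun_prop)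
  refine h.mono' hm.aestronglyMeasurable (Eventually.of_forall fun y => ?_)
  rw [norm_div, norm_pow, norm_norm, zero_sub, norm_neg, Real.rpow_neg (norm_nonneg _)]
  rcases eq_or_ne y 0 with rfl | hy
  · simp
  have hy' : 0 < ‖y‖ := norm_pos_iff.2 hy
  rw [div_le_iff₀ (by positivity)]
  refine (norm_inner_le_norm x y).trans_eq ?_
  rw [Real.rpow_two]
  field_simp

/-- The potential `∫_{B_r} (1/|x-y| - 1/|y|) f(y) dy`, normalised to vanish at the origin. -/
noncomputable def newtonPotential (r : ℝ) (f : Space3 → ℝ) (x : Space3) : ℝ :=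
  ∫ y in closedBall (0 : Space3) r, (1 / ‖x - y‖ - 1 / ‖y‖) * f y

lemma IntegrableOn.mul_of_abs_le {k f : Space3 → ℝ} {r M : ℝ}
    (hk : IntegrableOn k (closedBall 0 r))
    (hf : AEStronglyMeasurable f (volume.restrict (closedBall (0 : Space3) r)))
    (hM : ∀ y ∈ closedBall (0 : Space3) r, |f y| ≤ M) :
    IntegrableOn (fun y => k y * f y) (closedBall 0 r) :=
  Integrable.mul_bdd (c := M) hk hf
    ((ae_restrict_iff' measurableSet_closedBall).2 (Eventually.of_forall hM))

lemma abs_setIntegral_mul_le {k g f : Space3 → ℝ} {r M : ℝ}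
    (hM : ∀ y ∈ closedBall (0 : Space3) r, |f y| ≤ M)
    (hg : IntegrableOn g (closedBall 0 r)) (hkg : ∀ y, |k y| ≤ g y) :
    |∫ y in closedBall (0 : Space3) r, k y * f y| ≤ (∫ y in closedBall (0 : Space3) r, g y) * M := by
  rw [← integral_mul_const, ← Real.norm_eq_abs]
  refine norm_integral_le_of_norm_le (hg.mul_const M)
    ((ae_restrict_iff' measurableSet_closedBall).2 (Eventually.of_forall fun y hy => ?_))
  rw [norm_mul]
  exact mul_le_mul (hkg y) (hM y hy) (abs_nonneg _) ((abs_nonneg _).trans (hkg y))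

lemma abs_one_div_sub_one_div_le {a b d : ℝ} (ha : 0 ≤ a) (hb : 0 ≤ b) (h : |a - b| ≤ d) :
    |1 / a - 1 / b| ≤ d * (a ^ (-2 : ℝ) + b ^ (-2 : ℝ)) := by
  rw [Real.rpow_neg ha, Real.rpow_neg hb, Real.rpow_two, Real.rpow_two]
  have hd : 0 ≤ d := (abs_nonneg _).trans h
  rcases ha.eq_or_lt with rfl | ha
  · rcases hb.eq_or_lt with rfl | hb
    · simp
    · rw [zero_sub, abs_neg, abs_of_pos hb] at h
      rw [div_zero, zero_sub, abs_neg, abs_of_pos (by positivity)]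
      simp only [ne_eq, OfNat.ofNat_ne_zero, not_false_eq_true, zero_pow, inv_zero, zero_add]
      rw [div_le_iff₀ hb]
      field_simp
      exact h
  rcases hb.eq_or_lt with rfl | hb
  · rw [sub_zero, abs_of_pos ha] at h
    rw [div_zero, sub_zero, abs_of_pos (by positivity)]
    simp only [ne_eq, OfNat.ofNat_ne_zero, not_false_eq_true, zero_pow, inv_zero, add_zero]
    rw [div_le_iff₀ ha]
    field_simp
    exact h
  have e : 1 / a - 1 / b = (b - a) * (1 / (a * b)) := by field_simp
  rw [e, abs_mul, abs_sub_comm, abs_of_pos (by positivity : 0 < 1 / (a * b))]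
  refine mul_le_mul h ?_ (by positivity) hd
  have e2 : 1 / (a * b) = a⁻¹ * b⁻¹ := by rw [one_div, mul_inv]
  rw [e2, ← inv_pow, ← inv_pow]
  nlinarith [sq_nonneg (a⁻¹ - b⁻¹), sq_nonneg a⁻¹, sq_nonneg b⁻¹]

lemma exists_newtonPotential_lipschitz (R r : ℝ) :
    ∃ L : ℝ, ∀ (f : Space3 → ℝ) (M : ℝ), 0 ≤ M →
      AEStronglyMeasurable f (volume.restrict (closedBall (0 : Space3) r)) →
      (∀ y ∈ closedBall (0 : Space3) r, |f y| ≤ M) →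
      ∀ x x' : Space3, ‖x‖ ≤ R → ‖x'‖ ≤ R →
        |newtonPotential r f x - newtonPotential r f x'| ≤ L * M * ‖x - x'‖ := by
  obtain ⟨J, hJ⟩ := exists_setIntegral_norm_sub_rpow_neg_le (p := 2) (by norm_num) R r
  refine ⟨2 * J, fun f M hM0 hf hM x x' hx hx' => ?_⟩
  have hsub : newtonPotential r f x - newtonPotential r f x' =
      ∫ y in closedBall (0 : Space3) r, (1 / ‖x - y‖ - 1 / ‖x' - y‖) * f y := by
    unfold newtonPotential
    rw [← integral_sub (IntegrableOn.mul_of_abs_le (integrableOn_newtonKernel r x) hf hM)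
      (IntegrableOn.mul_of_abs_le (integrableOn_newtonKernel r x') hf hM)]
    congr 1 with y
    ring
  obtain ⟨h1, h2⟩ := hJ x hx
  obtain ⟨h1', h2'⟩ := hJ x' hx'
  rw [hsub]
  refine (abs_setIntegral_mul_le hM ((h1.add h1').const_mul ‖x - x'‖) fun y =>
    abs_one_div_sub_one_div_le (norm_nonneg _) (norm_nonneg _) ?_).trans ?_
  · simpa using abs_norm_sub_norm_le (x - y) (x' - y)
  · rw [integral_const_mul]
    simp only [Pi.add_apply]
    rw [integral_add h1 h1']
    nlinarith [mul_nonneg (norm_nonneg (x - x')) hM0]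

lemma abs_newtonKernel_sub_linear_le_of_pos {a b r q : ℝ} (ha : 0 < a) (hb : 0 < b) (hr : 0 ≤ r)
    (hab : |b - a| ≤ r) (hq : a ^ 2 = b ^ 2 - 2 * q + r ^ 2) (hqr : |q| ≤ r * b) :
    |1 / a - 1 / b - q / b ^ 3| ≤ r * √r * (2 * (a ^ (-(5 / 2) : ℝ) + b ^ (-(5 / 2) : ℝ))) := by
  have key : ∀ t : ℝ, 0 < t → t ^ (-(5 / 2) : ℝ) = 1 / √t ^ 5 := by
    intro t ht
    rw [Real.rpow_neg ht.le, Real.sqrt_eq_rpow, ← Real.rpow_natCast, ← Real.rpow_mul ht.le]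
    norm_num
  rw [key a ha, key b hb]
  obtain ⟨α, hα, rfl⟩ : ∃ α, 0 < α ∧ α ^ 2 = a := ⟨√a, by positivity, Real.sq_sqrt ha.le⟩
  obtain ⟨β, hβ, rfl⟩ : ∃ β, 0 < β ∧ β ^ 2 = b := ⟨√b, by positivity, Real.sq_sqrt hb.le⟩
  obtain ⟨ρ, hρ, rfl⟩ : ∃ ρ, 0 ≤ ρ ∧ ρ ^ 2 = r := ⟨√r, by positivity, Real.sq_sqrt hr⟩
  rw [Real.sqrt_sq hα.le, Real.sqrt_sq hβ.le, Real.sqrt_sq hρ]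
  have hmid : |1 / α ^ 2 - 1 / β ^ 2 - q / (β ^ 2) ^ 3| ≤
      ρ ^ 2 * ρ * (1 / (α ^ 2 * β ^ 3) + 1 / β ^ 5) := by
    rcases le_total ρ β with h | h
    · have e : 1 / α ^ 2 - 1 / β ^ 2 - q / (β ^ 2) ^ 3 =
          (β ^ 2 - α ^ 2) ^ 2 * (1 / (α ^ 2 * β ^ 4) + 1 / (2 * β ^ 6))
            - (ρ ^ 2) ^ 2 * (1 / (2 * β ^ 6)) := by
        have : q = (β ^ 4 - α ^ 4 + ρ ^ 4) / 2 := by linarith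
        rw [this]
        field_simp
        ring
      have hsq : (β ^ 2 - α ^ 2) ^ 2 ≤ (ρ ^ 2) ^ 2 := by
        rw [← sq_abs]; exact pow_le_pow_left₀ (abs_nonneg _) hab 2
      have hbd : |1 / α ^ 2 - 1 / β ^ 2 - q / (β ^ 2) ^ 3| ≤
          (ρ ^ 2) ^ 2 * (1 / (α ^ 2 * β ^ 4) + 1 / β ^ 6) := by
        have p1 : 0 < 1 / (α ^ 2 * β ^ 4) := by positivity
        have p2 : 0 < 1 / (2 * β ^ 6) := by positivity
        have p3 : 1 / β ^ 6 = 2 * (1 / (2 * β ^ 6)) := by field_simp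
        rw [e, p3, abs_le]
        constructor <;>
          nlinarith [mul_le_mul_of_nonneg_right hsq p1.le, mul_le_mul_of_nonneg_right hsq p2.le,
            mul_nonneg (sq_nonneg (β ^ 2 - α ^ 2)) p1.le,
            mul_nonneg (sq_nonneg (β ^ 2 - α ^ 2)) p2.le,
            mul_nonneg (sq_nonneg (ρ ^ 2)) p1.le, mul_nonneg (sq_nonneg (ρ ^ 2)) p2.le]
      refine hbd.trans ?_
      have e2 : ρ ^ 2 * ρ * (1 / (α ^ 2 * β ^ 3) + 1 / β ^ 5) =
          ρ ^ 2 * (ρ * β) * (1 / (α ^ 2 * β ^ 4) + 1 / β ^ 6) := by field_simp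
      rw [e2]
      refine mul_le_mul_of_nonneg_right ?_ (by positivity)
      nlinarith [mul_nonneg (sq_nonneg ρ) hρ, mul_nonneg (mul_nonneg (sq_nonneg ρ) hρ) (sub_nonneg.2 h)]
    · have hbd : |1 / α ^ 2 - 1 / β ^ 2 - q / (β ^ 2) ^ 3| ≤
          ρ ^ 2 * (1 / (α ^ 2 * β ^ 2) + 1 / β ^ 4) := by
        have e : 1 / α ^ 2 - 1 / β ^ 2 = (β ^ 2 - α ^ 2) * (1 / (α ^ 2 * β ^ 2)) := by field_simp
        have e' : ρ ^ 2 * (1 / β ^ 4) = ρ ^ 2 * β ^ 2 / (β ^ 2) ^ 3 := by field_simp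
        refine (abs_sub _ _).trans ?_
        rw [mul_add, e, abs_mul, abs_of_pos (by positivity : 0 < 1 / (α ^ 2 * β ^ 2)),
          abs_div q, abs_of_pos (by positivity : 0 < (β ^ 2) ^ 3), e']
        gcongr
      refine hbd.trans ?_
      have e2 : ρ ^ 2 * (1 / (α ^ 2 * β ^ 2) + 1 / β ^ 4) =
          ρ ^ 2 * β * (1 / (α ^ 2 * β ^ 3) + 1 / β ^ 5) := by field_simp
      rw [e2]
      gcongr
  refine hmid.trans ?_
  refine mul_le_mul_of_nonneg_left ?_ (by positivity)
  have p1 : 0 < 1 / α ^ 5 := by positivity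
  have p2 : 0 < 1 / β ^ 5 := by positivity
  have : 1 / (α ^ 2 * β ^ 3) ≤ 1 / α ^ 5 + 1 / β ^ 5 := by
    rcases le_total α β with h | h
    · have : 1 / (α ^ 2 * β ^ 3) ≤ 1 / (α ^ 2 * α ^ 3) := by gcongr
      rw [← pow_add] at this
      linarith
    · have : 1 / (α ^ 2 * β ^ 3) ≤ 1 / (β ^ 2 * β ^ 3) := by gcongr
      rw [← pow_add] at this
      linarith
  linarith

lemma abs_newtonKernel_sub_linear_le (x y : Space3) :
    |1 / ‖x - y‖ - 1 / ‖y‖ - inner ℝ x y / ‖y‖ ^ 3| ≤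
      ‖x‖ * √‖x‖ * (2 * (‖x - y‖ ^ (-(5 / 2) : ℝ) + ‖0 - y‖ ^ (-(5 / 2) : ℝ))) := by
  have key : ∀ t : ℝ, 0 < t → t * √t * t ^ (-(5 / 2) : ℝ) = 1 / t := by
    intro t ht
    rw [Real.sqrt_eq_rpow, ← Real.rpow_one_add' ht.le (by norm_num), ← Real.rpow_add ht,
      one_div, ← Real.rpow_neg_one]
    norm_num [Real.rpow_neg_one]
  rw [zero_sub, norm_neg]
  rcases eq_or_ne y 0 with rfl | hy
  · rcases eq_or_ne x 0 with rfl | hx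
    · simp
    have hx' := norm_pos_iff.2 hx
    have := key _ hx'
    have h0 : 0 < 1 / ‖x‖ := by positivity
    rw [sub_zero, norm_zero, Real.zero_rpow (by norm_num)]
    simp only [inner_zero_right, zero_div, div_zero, sub_zero, add_zero]
    rw [abs_of_pos h0]
    nlinarith
  have hy' := norm_pos_iff.2 hy
  rcases eq_or_ne x y with rfl | hxy
  · have := key _ hy'
    rw [sub_self, norm_zero, Real.zero_rpow (by norm_num), real_inner_self_eq_norm_sq]
    have e : 1 / (0 : ℝ) - 1 / ‖x‖ - ‖x‖ ^ 2 / ‖x‖ ^ 3 = -(2 * (1 / ‖x‖)) := by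
      field_simp
      norm_num
    rw [e, abs_neg, abs_of_pos (by positivity), ← this]
    apply le_of_eq
    ring
  refine abs_newtonKernel_sub_linear_le_of_pos (norm_pos_iff.2 (sub_ne_zero.2 hxy)) hy'
    (norm_nonneg x) ?_ ?_ (abs_real_inner_le_norm x y)
  · have := abs_norm_sub_norm_le y (y - x)
    rwa [sub_sub_cancel, norm_sub_rev y x] at this
  · rw [norm_sub_sq_real]
    ring

lemma setIntegral_closedBall_eq_zero_of_odd {g : Space3 → ℝ} (r : ℝ) (hg : ∀ y, g (-y) = -g y) :
    ∫ y in closedBall (0 : Space3) r, g y = 0 := by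
  rw [← integral_indicator measurableSet_closedBall]
  set G := (closedBall (0 : Space3) r).indicator g with hG
  have h : ∀ y, G (-y) = -G y := fun y => by
    by_cases hy : y ∈ closedBall (0 : Space3) r
    · rw [hG, Set.indicator_of_mem hy, Set.indicator_of_mem (by simpa using hy), hg]
    · rw [hG, Set.indicator_of_notMem hy, Set.indicator_of_notMem (by simpa using hy), neg_zero]
  have h2 := integral_neg_eq_self G volume
  simp only [h, integral_neg] at h2
  linarith

lemma exists_newtonPotential_le (R r : ℝ) :
    ∃ A : ℝ, ∀ (f : Space3 → ℝ) (M : ℝ), 0 ≤ M →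
      AEStronglyMeasurable f (volume.restrict (closedBall (0 : Space3) r)) →
      (∀ y ∈ closedBall (0 : Space3) r, |f y| ≤ M) → (∀ y, f (-y) = f y) →
      ∀ x : Space3, ‖x‖ ≤ R → |newtonPotential r f x| ≤ A * M * (‖x‖ * √‖x‖) := by
  obtain ⟨J, hJ⟩ := exists_setIntegral_norm_sub_rpow_neg_le (p := 5 / 2) (by norm_num) (max R 0) r
  refine ⟨4 * J, fun f M hM0 hf hM heven x hx => ?_⟩
  have hsub : newtonPotential r f x =
      ∫ y in closedBall (0 : Space3) r,
        (1 / ‖x - y‖ - 1 / ‖y‖ - inner ℝ x y / ‖y‖ ^ 3) * f y := by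
    have h0 : ∫ y in closedBall (0 : Space3) r, inner ℝ x y / ‖y‖ ^ 3 * f y = 0 :=
      setIntegral_closedBall_eq_zero_of_odd r fun y => by
        rw [heven, inner_neg_right, norm_neg]; ring
    rw [newtonPotential, ← sub_zero (∫ _ in _, _), ← h0, ← integral_sub
      (IntegrableOn.mul_of_abs_le (integrableOn_newtonKernel r x) hf hM)
      (IntegrableOn.mul_of_abs_le (integrableOn_inner_div_norm_cube r x) hf hM)]
    congr 1 with y
    ring
  obtain ⟨h1, h2⟩ := hJ x (hx.trans (le_max_left _ _))
  obtain ⟨h1', h2'⟩ := hJ 0 (by simp)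
  rw [hsub]
  refine (abs_setIntegral_mul_le hM (((h1.add h1').const_mul 2).const_mul (‖x‖ * √‖x‖))
    fun y => abs_newtonKernel_sub_linear_le x y).trans ?_
  rw [integral_const_mul, integral_const_mul]
  simp only [Pi.add_apply]
  rw [integral_add h1 h1']
  have : 0 ≤ ‖x‖ * √‖x‖ * M := by positivity
  nlinarith

/-- Precompactness of `x ↦ V x / ‖x‖` for uniformly Lipschitz `V` that vanish uniformly to order
`3/2` at the origin. -/
lemma exists_subseq_tendstoUniformlyOn_div_norm {V : ℕ → Space3 → ℝ} {R L A : ℝ}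
    (hL : ∀ n x x', ‖x‖ ≤ R → ‖x'‖ ≤ R → |V n x - V n x'| ≤ L * ‖x - x'‖)
    (hA : ∀ n x, ‖x‖ ≤ R → |V n x| ≤ A * (‖x‖ * √‖x‖)) :
    ∃ σ : ℕ → ℕ, StrictMono σ ∧ ∃ W : Space3 → ℝ,
      TendstoUniformlyOn (fun k x => V (σ k) x / ‖x‖) W atTop (closedBall 0 R) := by
  have hW : ∀ n x, ‖x‖ ≤ R → |V n x / ‖x‖| ≤ |A| * √‖x‖ := by
    intro n x hx
    rcases eq_or_ne x 0 with rfl | hx0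
    · simp
    have hx' := norm_pos_iff.2 hx0
    rw [abs_div, abs_norm, div_le_iff₀ hx']
    refine (hA n x hx).trans ?_
    have := mul_le_mul_of_nonneg_right (le_abs_self A) (by positivity : 0 ≤ ‖x‖ * √‖x‖)
    linarith
  have hV : ∀ n x, ‖x‖ ≤ R → V n x / ‖x‖ * ‖x‖ = V n x := by
    intro n x hx
    rcases eq_or_ne x 0 with rfl | hx0
    · have := hA n 0 hx
      rw [norm_zero, zero_mul, mul_zero] at this
      simp [abs_nonpos_iff.1 this]
    · exact div_mul_cancel₀ _ (norm_ne_zero_iff.2 hx0)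
  have hmem : ∀ x : closedBall (0 : Space3) R, ‖(x : Space3)‖ ≤ R := fun x => mem_closedBall_zero_iff.1 x.2
  let F : ℕ → closedBall (0 : Space3) R → ℝ := fun n x => V n x / ‖(x : Space3)‖
  have hF : Equicontinuous F := by
    intro x₀
    by_cases h0 : (x₀ : Space3) = 0
    · refine equicontinuousAt_of_continuity_modulus
        (fun x : closedBall (0 : Space3) R => |A| * √‖(x : Space3)‖) ?_ F
        (Eventually.of_forall fun x n => ?_)
      · have : Continuous fun x : closedBall (0 : Space3) R => |A| * √‖(x : Space3)‖ := by fun_prop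
        simpa [h0] using this.tendsto x₀
      · simpa [F, h0, Real.dist_eq] using hW n x (hmem x)
    · have hx₀ : 0 < ‖(x₀ : Space3)‖ := norm_pos_iff.2 h0
      refine equicontinuousAt_of_continuity_modulus
        (fun x : closedBall (0 : Space3) R => (L + |A| * √‖(x : Space3)‖) * ‖(x₀ : Space3) - x‖ / ‖(x₀ : Space3)‖) ?_ F
        (Eventually.of_forall fun x n => ?_)
      · have : Continuous fun x : closedBall (0 : Space3) R =>
            (L + |A| * √‖(x : Space3)‖) * ‖(x₀ : Space3) - x‖ / ‖(x₀ : Space3)‖ := by fun_prop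
        simpa using this.tendsto x₀
      · have e : F n x₀ - F n x =
            ((V n x₀ - V n x) + F n x * (‖(x : Space3)‖ - ‖(x₀ : Space3)‖)) / ‖(x₀ : Space3)‖ := by
          have h1 := hV n x (hmem x)
          simp only [F]
          rw [mul_sub, h1]
          field_simp
          ring
        rw [Real.dist_eq, e, abs_div, abs_norm]
        refine div_le_div_of_nonneg_right ?_ hx₀.le
        rw [add_mul]
        refine (abs_add_le _ _).trans (add_le_add (hL n _ _ (hmem x₀) (hmem x)) ?_)
        rw [abs_mul]
        refine mul_le_mul (hW n x (hmem x)) ?_ (abs_nonneg _) (by positivity)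
        rw [norm_sub_rev]
        exact abs_norm_sub_norm_le _ _
  let b : ℕ → BoundedContinuousFunction (closedBall (0 : Space3) R) ℝ := fun n =>
    BoundedContinuousFunction.mkOfCompact ⟨F n, hF.continuous n⟩
  have hcomp : IsCompact (closure (Set.range b)) := by
    refine BoundedContinuousFunction.arzela_ascoli (Set.Icc (-(|A| * √R)) (|A| * √R)) isCompact_Icc
      _ ?_ ?_
    · rintro _ x ⟨n, rfl⟩
      refine abs_le.1 ((hW n x (hmem x)).trans ?_)
      gcongr
      exact hmem x
    · intro x U hU
      filter_upwards [hF x U hU] with y hy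
      rintro ⟨_, n, rfl⟩
      exact hy n
  obtain ⟨g, -, σ, hσ, hlim⟩ :=
    hcomp.tendsto_subseq fun n => subset_closure (Set.mem_range_self n)
  refine ⟨σ, hσ, Function.extend Subtype.val g 0, ?_⟩
  rw [tendstoUniformlyOn_iff_tendstoUniformly_comp_coe]
  have hu := BoundedContinuousFunction.tendsto_iff_tendstoUniformly.1 hlim
  have hg : (Function.extend Subtype.val g 0) ∘ ((↑) : closedBall (0 : Space3) R → Space3) = g :=
    funext fun x => Subtype.val_injective.extend_apply _ _ x
  rw [hg]
  exact hu

/-- the operator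
`(KΛ)(x) = -(1/U₀'(|x|)) ∫_{B₃}(1/|x-y| - 1/|y|) ρ₀'(|y|) Λ(y) dy` is a compact linear
operator on the space `C_S(B₄)` of continuous functions on `B₄` invariant under the
coordinate reflections, with the sup norm: it is linear, and every sequence in the unit
ball of `C_S(B₄)` has a subsequence whose `K`-images converge uniformly. -/
theorem stmt14 (ρ₀ : ℝ → ℝ) (hρC1 : ContDiff ℝ 1 ρ₀)
    (hρsupp : ∀ r : ℝ, 1 ≤ r → ρ₀ r = 0)
    (U₀' : ℝ → ℝ) (C : ℝ) (hC : 0 < C)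
    (hU' : ∀ r : ℝ, 0 < r → U₀' r = (4 * π / r^2) * ∫ s in (0:ℝ)..r, s^2 * ρ₀ s)
    (hU'low : ∀ r ∈ Set.Icc (0:ℝ) 4, C * r ≤ U₀' r)
    (K : (EuclideanSpace ℝ (Fin 3) → ℝ) → (EuclideanSpace ℝ (Fin 3) → ℝ))
    (hK : ∀ (Λ : EuclideanSpace ℝ (Fin 3) → ℝ) (x : EuclideanSpace ℝ (Fin 3)), x ≠ 0 →
      K Λ x = -(1 / U₀' ‖x‖) *
        ∫ y in closedBall (0 : EuclideanSpace ℝ (Fin 3)) 3,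
          (1 / ‖x - y‖ - 1 / ‖y‖) * deriv ρ₀ ‖y‖ * Λ y) :
    -- linearity of K on C_S(B₄)
    (∀ Λ Λ' : EuclideanSpace ℝ (Fin 3) → ℝ,
      ContinuousOn Λ (closedBall (0 : EuclideanSpace ℝ (Fin 3)) 4) →
      ContinuousOn Λ' (closedBall (0 : EuclideanSpace ℝ (Fin 3)) 4) →
      (∀ (i : Fin 3) x, Λ (coordFlip i x) = Λ x) →
      (∀ (i : Fin 3) x, Λ' (coordFlip i x) = Λ' x) →
      ∀ (c : ℝ) (x : EuclideanSpace ℝ (Fin 3)), x ≠ 0 →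
        K (fun y => c * Λ y + Λ' y) x = c * K Λ x + K Λ' x) ∧
    -- compactness of K on C_S(B₄)
    (∀ Λ : ℕ → (EuclideanSpace ℝ (Fin 3) → ℝ),
      (∀ n, ContinuousOn (Λ n) (closedBall (0 : EuclideanSpace ℝ (Fin 3)) 4)) →
      (∀ n (i : Fin 3) x, Λ n (coordFlip i x) = Λ n x) →
      (∀ n, ∀ x ∈ closedBall (0 : EuclideanSpace ℝ (Fin 3)) 4, |Λ n x| ≤ 1) →
      ∃ σ : ℕ → ℕ, StrictMono σ ∧
        ∃ G : EuclideanSpace ℝ (Fin 3) → ℝ,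
          TendstoUniformlyOn (fun k => K (Λ (σ k))) G atTop
            (closedBall (0 : EuclideanSpace ℝ (Fin 3)) 4 \ {0})) := by
  obtain ⟨D, hD⟩ : ∃ D : ℝ, ∀ y ∈ closedBall (0 : EuclideanSpace ℝ (Fin 3)) 3,
      |deriv ρ₀ ‖y‖| ≤ D :=
    (isCompact_closedBall _ _).exists_bound_of_continuousOn
      ((hρC1.continuous_deriv le_rfl).comp continuous_norm).continuousOn
  have hρmeas : Continuous fun y : EuclideanSpace ℝ (Fin 3) => deriv ρ₀ ‖y‖ :=
    (hρC1.continuous_deriv le_rfl).comp continuous_norm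
  have hsub : closedBall (0 : EuclideanSpace ℝ (Fin 3)) 3 ⊆ closedBall 0 4 :=
    closedBall_subset_closedBall (by norm_num)
  have hmeas : ∀ Λ : EuclideanSpace ℝ (Fin 3) → ℝ, ContinuousOn Λ (closedBall 0 4) →
      AEStronglyMeasurable (fun y => deriv ρ₀ ‖y‖ * Λ y)
        (volume.restrict (closedBall (0 : EuclideanSpace ℝ (Fin 3)) 3)) := fun Λ hΛ =>
    (hρmeas.continuousOn.mul (hΛ.mono hsub)).aestronglyMeasurable measurableSet_closedBall
  have hKV : ∀ (Λ : EuclideanSpace ℝ (Fin 3) → ℝ) (x : EuclideanSpace ℝ (Fin 3)), x ≠ 0 →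
      K Λ x = -(1 / U₀' ‖x‖) * newtonPotential 3 (fun y => deriv ρ₀ ‖y‖ * Λ y) x := by
    intro Λ x hx
    rw [hK Λ x hx, newtonPotential]
    simp only [mul_assoc]
  constructor
  · intro Λ Λ' hΛ hΛ' _ _ c x hx
    have hint : ∀ Λ : EuclideanSpace ℝ (Fin 3) → ℝ, ContinuousOn Λ (closedBall 0 4) →
        IntegrableOn (fun y => (1 / ‖x - y‖ - 1 / ‖y‖) * (deriv ρ₀ ‖y‖ * Λ y))
          (closedBall (0 : EuclideanSpace ℝ (Fin 3)) 3) := by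
      intro Λ hΛ
      obtain ⟨M, hM⟩ := (isCompact_closedBall (0 : EuclideanSpace ℝ (Fin 3)) 3)
        |>.exists_bound_of_continuousOn (hρmeas.continuousOn.mul (hΛ.mono hsub))
      exact IntegrableOn.mul_of_abs_le (integrableOn_newtonKernel 3 x) (hmeas Λ hΛ) hM
    rw [hKV _ x hx, hKV _ x hx, hKV _ x hx]
    have : newtonPotential 3 (fun y => deriv ρ₀ ‖y‖ * (c * Λ y + Λ' y)) x =
        c * newtonPotential 3 (fun y => deriv ρ₀ ‖y‖ * Λ y) x +
          newtonPotential 3 (fun y => deriv ρ₀ ‖y‖ * Λ' y) x := by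
      unfold newtonPotential
      rw [← integral_const_mul, ← integral_add ((hint Λ hΛ).const_mul c) (hint Λ' hΛ')]
      congr 1 with y
      ring
    rw [this]
    ring
  · intro Λ hcont hsymm hbdd
    have hD0 : 0 ≤ D := (abs_nonneg _).trans (hD 0 (by simp))
    have hbound : ∀ n, ∀ y ∈ closedBall (0 : EuclideanSpace ℝ (Fin 3)) 3,
        |deriv ρ₀ ‖y‖ * Λ n y| ≤ D := fun n y hy => by
      rw [abs_mul]
      exact (mul_le_mul (hD y hy) (hbdd n y (hsub hy)) (abs_nonneg _) hD0).trans_eq (mul_one D)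
    have heven : ∀ n y, deriv ρ₀ ‖-y‖ * Λ n (-y) = deriv ρ₀ ‖y‖ * Λ n y := fun n y => by
      rw [norm_neg, ← coordFlip_coordFlip_coordFlip, hsymm, hsymm, hsymm]
    obtain ⟨L, hL⟩ := exists_newtonPotential_lipschitz 4 3
    obtain ⟨A, hA⟩ := exists_newtonPotential_le 4 3
    obtain ⟨σ, hσ, W, hW⟩ := exists_subseq_tendstoUniformlyOn_div_norm
      (V := fun n => newtonPotential 3 fun y => deriv ρ₀ ‖y‖ * Λ n y)
      (fun n => hL _ D hD0 (hmeas _ (hcont n)) (hbound n))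
      (fun n => hA _ D hD0 (hmeas _ (hcont n)) (hbound n) (heven n))
    refine ⟨σ, hσ, fun x => -(‖x‖ / U₀' ‖x‖) * W x, ?_⟩
    rw [Metric.tendstoUniformlyOn_iff] at hW ⊢
    intro ε hε
    filter_upwards [hW (C * ε) (by positivity)] with k hk x hx
    have hx0 : x ≠ 0 := hx.2
    have hx' : 0 < ‖x‖ := norm_pos_iff.2 hx0
    have hlow := hU'low ‖x‖ ⟨hx'.le, mem_closedBall_zero_iff.1 hx.1⟩
    have hU0 : 0 < U₀' ‖x‖ := (mul_pos hC hx').trans_le hlow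
    have hkx := hk x hx.1
    rw [Real.dist_eq] at hkx ⊢
    rw [hKV _ x hx0]
    have e : ∀ v : ℝ, -(‖x‖ / U₀' ‖x‖) * W x - -(1 / U₀' ‖x‖) * v =
        -(‖x‖ / U₀' ‖x‖) * (W x - v / ‖x‖) := fun v => by
      field_simp
      ring
    rw [e, abs_mul, abs_neg, abs_of_pos (div_pos hx' hU0)]
    have hle : ‖x‖ / U₀' ‖x‖ ≤ 1 / C := by
      rw [div_le_div_iff₀ hU0 hC]
      linarith
    calc _ ≤ 1 / C * _ := mul_le_mul_of_nonneg_right hle (abs_nonneg _)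
      _ < 1 / C * (C * ε) := mul_lt_mul_of_pos_left hkx (by positivity)
      _ = ε := by field_simp
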